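/- arXiv:1207.3143 — 8 statements merged into one kernel-verified Lean document; each statement's English description precedes it below -/
import Mathlib

section
/- Let n ≥ 1 and suppose the zero set D of π_n consists of n distinct real numbers. Let p be a real polynomial and write p = q·π_n + r by polynomial division, where deg r < n. Then ∫ p dμ = c_n(q)·(∫ π_n² dμ) + Σ_{z∈D} p(z)·λ_z, where c_n(q) is the n-th Fourier coefficient of q and λ_z = ∫ l_z dμ. -/
open MeasureTheory Polynomial

/-- Gaussian-type quadrature error formula: if `D` is the zero set of the
`n`-th monic orthogonal polynomial `π n` (consisting of `n` distinct points) and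
`p = q * π n + r` with `deg r < n`, then
`∫ p dμ = c_n(q) · ∫ (π n)² dμ + Σ_{z ∈ D} p(z) · λ_z` where `λ_z = ∫ l_z dμ`. -/
theorem quadrature_error_formula
    (μ : Measure ℝ) [IsProbabilityMeasure μ]
    (hint : ∀ f : Polynomial ℝ, Integrable (fun x => f.eval x) μ)
    (π : ℕ → Polynomial ℝ)
    (hmonic : ∀ k, (π k).Monic)
    (hdeg : ∀ k, (π k).natDegree = k)
    (horth : ∀ j k, j ≠ k → ∫ x, (π j).eval x * (π k).eval x ∂μ = 0)
    (n : ℕ) (hn : 1 ≤ n)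
    (D : Finset ℝ) (hcard : D.card = n)
    (hzero : ∀ x : ℝ, x ∈ D ↔ (π n).eval x = 0)
    (p q r : Polynomial ℝ)
    (hdiv : p = q * π n + r) (hr : r.degree < n)
    (c : ℕ → ℝ) (N : ℕ) (hN : n < N)
    (hq : q = ∑ k ∈ Finset.range N, Polynomial.C (c k) * π k) :
    ∫ x, p.eval x ∂μ =
      c n * (∫ x, ((π n).eval x) ^ 2 ∂μ) +
        ∑ z ∈ D, p.eval z * (∫ x, (Lagrange.basis D id z).eval x ∂μ) := by
  have hprod : ∀ k, Integrable (fun x => c k * ((π k).eval x * (π n).eval x)) μ := fun k => by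
    simpa [mul_assoc] using hint (C (c k) * (π k * π n))
  have hqint : ∫ x, (q * π n).eval x ∂μ = c n * ∫ x, ((π n).eval x) ^ 2 ∂μ := by
    have heval : ∀ x, (q * π n).eval x =
        ∑ k ∈ Finset.range N, c k * ((π k).eval x * (π n).eval x) := fun x => by
      simp [hq, eval_finsetSum, Finset.sum_mul, mul_assoc]
    simp_rw [heval]
    rw [integral_finsetSum _ fun k _ => hprod k,
      Finset.sum_eq_single_of_mem n (Finset.mem_range.2 hN), integral_const_mul]
    · simp_rw [sq]
    · intro k _ hk
      rw [integral_const_mul, horth k n hk, mul_zero]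
  have hrint : ∫ x, r.eval x ∂μ =
      ∑ z ∈ D, p.eval z * ∫ x, (Lagrange.basis D id z).eval x ∂μ := by
    have hinterp : r = Lagrange.interpolate D id fun z => r.eval (id z) :=
      Lagrange.eq_interpolate (Function.injective_id.injOn) (by rwa [hcard])
    have heval : ∀ x, r.eval x = ∑ z ∈ D, p.eval z * (Lagrange.basis D id z).eval x := fun x => by
      conv_lhs => rw [hinterp]
      rw [Lagrange.interpolate_apply, eval_finsetSum]
      refine Finset.sum_congr rfl fun z hz => ?_
      simp [hdiv, (hzero z).1 hz]
    simp_rw [heval]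
    rw [integral_finsetSum _ fun z _ => (hint _).const_mul _]
    simp_rw [integral_const_mul]
  rw [← hqint, ← hrint, ← integral_add (hint _) (hint _)]
  simp only [hdiv, eval_add]
end

section
/- Let n ≥ 1 and suppose the zero set D of π_n consists of n distinct real numbers. Let f be a real polynomial and i ≥ 0 an integer such that deg f + i ≤ 2n − 1. Then (∫ π_i² dμ)·c_i(f) = Σ_{z∈D} f(z)·π_i(z)·λ_z; in particular, taking i = 0, c_0(f) = Σ_{z∈D} f(z)·λ_z for every polynomial f with deg f ≤ 2n − 1. -/
open MeasureTheory Polynomial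

/-- In a monic orthogonal system, `π n` is orthogonal to every polynomial of degree below `n`. -/
theorem integral_mul_eq_zero_of_degree_lt
    {μ : Measure ℝ}
    (hint : ∀ f : Polynomial ℝ, Integrable (fun x => f.eval x) μ)
    {π : ℕ → Polynomial ℝ}
    (hmonic : ∀ k, (π k).Monic)
    (hdeg : ∀ k, (π k).natDegree = k)
    (horth : ∀ j k, j ≠ k → ∫ x, (π j).eval x * (π k).eval x ∂μ = 0)
    {n : ℕ} {q : Polynomial ℝ} (hq : q.degree < n) :
    ∫ x, (π n * q).eval x ∂μ = 0 := by
  suffices H : ∀ m ≤ n, ∀ q : Polynomial ℝ, q.degree < m → ∫ x, (π n * q).eval x ∂μ = 0 from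
    H n le_rfl q hq
  intro m
  induction m with
  | zero =>
    intro _ q hq
    have hq0 : q = 0 := by simpa using hq
    simp [hq0]
  | succ m ih =>
    intro hm q hq
    have hlow : (q - C (q.coeff m) * π m).degree < m := by
      rw [degree_lt_iff_coeff_zero] at hq ⊢
      intro k hk
      rcases hk.eq_or_lt with rfl | hk
      · have hlead : (π m).coeff m = 1 := by
          simpa [Monic, leadingCoeff, hdeg] using hmonic m
        simp [hlead]
      · have hcoeff : (π m).coeff k = 0 := coeff_eq_zero_of_natDegree_lt (by rwa [hdeg])
        simp [hcoeff, hq k hk]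
    have hsplit : ∀ x, (π n * q).eval x = (π n * (q - C (q.coeff m) * π m)).eval x
        + q.coeff m * ((π n).eval x * (π m).eval x) := by
      intro x
      simp only [eval_mul, eval_sub, eval_C]
      ring
    have hprod : Integrable (fun x => (π n).eval x * (π m).eval x) μ := by
      simpa only [eval_mul] using hint (π n * π m)
    simp only [hsplit]
    rw [integral_add (hint _) (hprod.const_mul _), integral_const_mul, horth n m (by omega),
      ih (by omega) _ hlow]
    simp

/-- Interpolatory quadrature is exact on polynomials of degree below the number of nodes. -/
theorem integral_eq_sum_of_degree_lt_card
    {μ : Measure ℝ}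
    (hint : ∀ f : Polynomial ℝ, Integrable (fun x => f.eval x) μ)
    {D : Finset ℝ} {r : Polynomial ℝ} (hr : r.degree < D.card) :
    ∫ x, r.eval x ∂μ = ∑ z ∈ D, r.eval z * ∫ x, (Lagrange.basis D id z).eval x ∂μ := by
  have hinterp := Lagrange.eq_interpolate (v := id) Function.injective_id.injOn hr
  have heval : ∀ x, r.eval x = ∑ z ∈ D, r.eval z * (Lagrange.basis D id z).eval x := by
    intro x
    conv_lhs => rw [hinterp, Lagrange.interpolate_apply]
    simp [eval_finsetSum]
  calc ∫ x, r.eval x ∂μ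
      = ∫ x, ∑ z ∈ D, r.eval z * (Lagrange.basis D id z).eval x ∂μ := by simp only [← heval]
    _ = _ := by
      rw [integral_finsetSum _ fun z _ => (hint _).const_mul _]
      simp only [integral_const_mul]

/-- Gaussian quadrature: the zeros of `π n` integrate polynomials of degree below `2 * n`
exactly. -/
theorem integral_eq_sum_of_natDegree_lt_two_mul
    {μ : Measure ℝ}
    (hint : ∀ f : Polynomial ℝ, Integrable (fun x => f.eval x) μ)
    {π : ℕ → Polynomial ℝ}
    (hmonic : ∀ k, (π k).Monic)
    (hdeg : ∀ k, (π k).natDegree = k)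
    (horth : ∀ j k, j ≠ k → ∫ x, (π j).eval x * (π k).eval x ∂μ = 0)
    {n : ℕ} {D : Finset ℝ} (hcard : D.card = n)
    (hzero : ∀ x ∈ D, (π n).eval x = 0)
    {g : Polynomial ℝ} (hg : g.natDegree < 2 * n) :
    ∫ x, g.eval x ∂μ = ∑ z ∈ D, g.eval z * ∫ x, (Lagrange.basis D id z).eval x ∂μ := by
  have hdiv := modByMonic_add_div g (π n)
  have hrem : (g %ₘ π n).degree < D.card := by
    rw [hcard]
    have h := degree_modByMonic_lt g (hmonic n)
    rwa [degree_eq_natDegree (hmonic n).ne_zero, hdeg] at h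
  have hquot : (g /ₘ π n).degree < n := by
    refine degree_le_natDegree.trans_lt ?_
    rw [natDegree_divByMonic _ (hmonic n), hdeg]
    exact_mod_cast (by omega : g.natDegree - n < n)
  have hnode : ∀ z ∈ D, g.eval z = (g %ₘ π n).eval z := by
    intro z hz
    conv_lhs => rw [← hdiv]
    simp [hzero z hz]
  have hsplit : ∀ x, g.eval x = (g %ₘ π n).eval x + (π n * (g /ₘ π n)).eval x := by
    intro x
    rw [← eval_add, hdiv]
  calc ∫ x, g.eval x ∂μ
      = ∫ x, (g %ₘ π n).eval x + (π n * (g /ₘ π n)).eval x ∂μ := by simp only [← hsplit]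
    _ = ∫ x, (g %ₘ π n).eval x ∂μ := by
      rw [integral_add (hint _) (hint _),
        integral_mul_eq_zero_of_degree_lt hint hmonic hdeg horth hquot, add_zero]
    _ = _ := by
      rw [integral_eq_sum_of_degree_lt_card hint hrem]
      exact Finset.sum_congr rfl fun z hz => by rw [hnode z hz]

/-- Integrating an orthogonal expansion against `π i` extracts its `i`-th coefficient. -/
theorem integral_sum_mul_eq
    {μ : Measure ℝ}
    (hint : ∀ f : Polynomial ℝ, Integrable (fun x => f.eval x) μ)
    {π : ℕ → Polynomial ℝ}
    (horth : ∀ j k, j ≠ k → ∫ x, (π j).eval x * (π k).eval x ∂μ = 0)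
    (c : ℕ → ℝ) {s : Finset ℕ} {i : ℕ} (hi : i ∈ s) :
    ∫ x, ((∑ k ∈ s, C (c k) * π k) * π i).eval x ∂μ = (∫ x, ((π i).eval x) ^ 2 ∂μ) * c i := by
  have hprod : ∀ k, Integrable (fun x => (π k).eval x * (π i).eval x) μ := fun k => by
    simpa only [eval_mul] using hint (π k * π i)
  simp only [eval_mul, eval_finsetSum, eval_C, Finset.sum_mul, mul_assoc]
  rw [integral_finsetSum _ fun k _ => (hprod k).const_mul _]
  simp only [integral_const_mul]
  rw [Finset.sum_eq_single_of_mem i hi fun k _ hk => by rw [horth k i hk, mul_zero]]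
  simp only [← sq]
  exact mul_comm _ _

/-- Identification of Fourier coefficients by quadrature: if `D` is the zero
set of `π n` (with `n` distinct points) and `deg f + i ≤ 2n − 1`, then
`(∫ π_i² dμ) · c_i(f) = Σ_{z∈D} f(z)·π_i(z)·λ_z`. -/
theorem fourier_coefficient_identification
    (μ : Measure ℝ) [IsProbabilityMeasure μ]
    (hint : ∀ f : Polynomial ℝ, Integrable (fun x => f.eval x) μ)
    (π : ℕ → Polynomial ℝ)
    (hmonic : ∀ k, (π k).Monic)
    (hdeg : ∀ k, (π k).natDegree = k)
    (horth : ∀ j k, j ≠ k → ∫ x, (π j).eval x * (π k).eval x ∂μ = 0)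
    (n : ℕ) (hn : 1 ≤ n)
    (D : Finset ℝ) (hcard : D.card = n)
    (hzero : ∀ x : ℝ, x ∈ D ↔ (π n).eval x = 0)
    (f : Polynomial ℝ) (i : ℕ)
    (hdegfi : f.natDegree + i ≤ 2 * n - 1)
    (c : ℕ → ℝ) (N : ℕ) (hN : i < N)
    (hf : f = ∑ k ∈ Finset.range N, Polynomial.C (c k) * π k) :
    (∫ x, ((π i).eval x) ^ 2 ∂μ) * c i =
      ∑ z ∈ D, f.eval z * (π i).eval z * (∫ x, (Lagrange.basis D id z).eval x ∂μ) := by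
  have hg : (f * π i).natDegree < 2 * n := by
    have h := natDegree_mul_le (p := f) (q := π i)
    rw [hdeg] at h
    omega
  have hquad := integral_eq_sum_of_natDegree_lt_two_mul hint hmonic hdeg horth hcard
    (fun x hx => (hzero x).mp hx) hg
  have hcoeff := integral_sum_mul_eq hint horth c (Finset.mem_range.mpr hN)
  rw [← hf] at hcoeff
  rw [← hcoeff, hquad]
  simp only [eval_mul]
end

section
/- For all nonnegative integers k and n, the following identity of real polynomials holds: H_k·H_n = H_{n+k} + Σ_{i=1}^{min(n,k)} (n choose i)·(k choose i)·i!·H_{n+k−2i}. -/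
open Polynomial

/-- The probabilists' Hermite polynomials, defined by `H_0 = 1`, `H_1 = X` and the
three-term recurrence `H_{n+1}(x) = x·H_n(x) − n·H_{n−1}(x)`. -/
noncomputable def hermiteR : ℕ → Polynomial ℝ
  | 0 => 1
  | 1 => Polynomial.X
  | n + 2 => Polynomial.X * hermiteR (n + 1) - Polynomial.C ((n : ℝ) + 1) * hermiteR n

theorem X_mul_hermiteR (m : ℕ) :
    X * hermiteR m = hermiteR (m + 1) + C (m : ℝ) * hermiteR (m - 1) := by
  cases m with
  | zero => simp [hermiteR]
  | succ m => simp [hermiteR]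

/-- The product formula summed over any range containing `0, …, k`; the coefficients vanish for
`i > min n k`. -/
theorem hermiteR_mul_eq_sum_range (n k : ℕ) : ∀ M, k < M →
    hermiteR k * hermiteR n =
      ∑ i ∈ Finset.range M,
        C ((k.choose i : ℝ) * (n.descFactorial i : ℝ)) * hermiteR (n + k - 2 * i) := by
  induction k using Nat.twoStepInduction with
  | zero =>
    intro M hM
    rw [Finset.sum_eq_single_of_mem 0 (by simpa using hM)]
    · simp [hermiteR]
    · intro i _ hi
      simp [Nat.choose_eq_zero_of_lt (Nat.pos_of_ne_zero hi)]
  | one =>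
    intro M hM
    obtain ⟨M, rfl⟩ := Nat.exists_eq_add_of_lt hM
    rw [show 1 + M + 1 = (M + 1) + 1 by ring, Finset.sum_range_succ', Finset.sum_range_succ',
      Finset.sum_eq_zero]
    · simp only [hermiteR, X_mul_hermiteR]
      rw [show n + 1 - 2 * (0 + 1) = n - 1 by lia]
      simp [add_comm]
    · intro i _
      simp [Nat.choose_eq_zero_of_lt (show 1 < i + 1 + 1 by lia)]
  | more k ih₀ ih₁ =>
    intro M hM
    obtain ⟨M, rfl⟩ : ∃ M', M = M' + 1 := ⟨M - 1, by lia⟩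
    have hX : ∀ i, X * (C (((k + 1).choose i : ℝ) * (n.descFactorial i : ℝ)) *
          hermiteR (n + (k + 1) - 2 * i)) =
        C (((k + 1).choose i : ℝ) * (n.descFactorial i : ℝ)) * hermiteR (n + (k + 2) - 2 * i) +
        C (((k + 1).choose i : ℝ) * (n.descFactorial i : ℝ) * ((n : ℝ) + k + 1 - 2 * i)) *
          hermiteR (n + k - 2 * i) := by
      intro i
      by_cases hk : k + 1 < i
      · simp [Nat.choose_eq_zero_of_lt hk]
      by_cases hn : n < i
      · simp [Nat.descFactorial_of_lt hn]
      rw [mul_left_comm, X_mul_hermiteR, show n + (k + 1) - 2 * i + 1 = n + (k + 2) - 2 * i by lia,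
        show n + (k + 1) - 2 * i - 1 = n + k - 2 * i by lia, Nat.cast_sub (by lia)]
      simp only [C_mul, Nat.cast_add, Nat.cast_mul, Nat.cast_one, Nat.cast_ofNat, ← add_assoc]
      ring
    have hc : ∀ i, ((k + 2).choose (i + 1) : ℝ) * (n.descFactorial (i + 1) : ℝ) =
        ((k + 1).choose (i + 1) : ℝ) * (n.descFactorial (i + 1) : ℝ) +
        ((k + 1).choose i : ℝ) * (n.descFactorial i : ℝ) * ((n : ℝ) + k + 1 - 2 * i) -
        ((k : ℝ) + 1) * ((k.choose i : ℝ) * (n.descFactorial i : ℝ)) := by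
      intro i
      by_cases hk : k + 1 < i
      · simp [Nat.choose_eq_zero_of_lt hk, Nat.choose_eq_zero_of_lt (show k < i by lia),
          Nat.choose_eq_zero_of_lt (show k + 1 < i + 1 by lia),
          Nat.choose_eq_zero_of_lt (show k + 2 < i + 1 by lia)]
      by_cases hn : n < i
      · simp [Nat.descFactorial_of_lt hn, Nat.descFactorial_succ]
      have h := congrArg (Nat.cast (R := ℝ)) (Nat.choose_mul_succ_eq k i)
      rw [Nat.choose_succ_succ (k + 1) i, Nat.descFactorial_succ]
      push_cast [Nat.cast_sub (show i ≤ k + 1 by lia), Nat.cast_sub (show i ≤ n by lia)] at h ⊢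
      linear_combination (n.descFactorial i : ℝ) * h
    have hrec : hermiteR (k + 2) * hermiteR n = X * (hermiteR (k + 1) * hermiteR n) -
        C ((k : ℝ) + 1) * (hermiteR k * hermiteR n) := by
      rw [hermiteR]
      ring
    rw [hrec, ih₁ (M + 1) (by lia), ih₀ M (by lia), Finset.mul_sum, Finset.sum_congr rfl
      fun i _ => hX i, Finset.sum_add_distrib, Finset.sum_range_succ', Finset.sum_range_succ _ M,
      Finset.sum_range_succ', Nat.choose_eq_zero_of_lt (show k + 1 < M by lia), Finset.mul_sum]
    have hidx : ∀ i, n + (k + 2) - 2 * (i + 1) = n + k - 2 * i := by lia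
    simp only [hc, hidx, C_add, C_sub, add_mul, sub_mul, Finset.sum_add_distrib,
      Finset.sum_sub_distrib, C_mul, Nat.choose_zero_right, Nat.cast_zero, C_0, zero_mul]
    simp only [mul_add, mul_sub, add_mul, sub_mul, mul_assoc, Finset.sum_add_distrib,
      Finset.sum_sub_distrib]
    ring

/-- Product formula for Hermite polynomials:
`H_k · H_n = H_{n+k} + Σ_{i=1}^{min(n,k)} (n choose i)·(k choose i)·i!·H_{n+k−2i}`. -/
theorem hermite_product_formula (k n : ℕ) :
    hermiteR k * hermiteR n =
      hermiteR (n + k) +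
        ∑ i ∈ Finset.Icc 1 (min n k),
          Polynomial.C ((n.choose i : ℝ) * (k.choose i : ℝ) * (Nat.factorial i : ℝ)) *
            hermiteR (n + k - 2 * i) := by
  rw [hermiteR_mul_eq_sum_range n k (k + 1) k.lt_succ_self, Finset.range_eq_Ico,
    Finset.sum_eq_sum_Ico_succ_bot k.succ_pos]
  congr 1
  · simp
  symm
  refine Finset.sum_subset_zero_on_sdiff (fun i hi => ?_) (fun i hi => ?_) (fun i _ => ?_)
  · simp only [Finset.mem_Icc, Finset.mem_Ico] at hi ⊢
    lia
  · simp only [Finset.mem_sdiff, Finset.mem_Icc, Finset.mem_Ico] at hi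
    simp [Nat.descFactorial_of_lt (show n < i by lia)]
  · rw [Nat.descFactorial_eq_factorial_mul_choose, Nat.cast_mul]
    congr 2
    ring
end

section
/- Let n, k be nonnegative integers and let x ∈ ℝ be a zero of H_n, i.e. H_n(x) = 0. Then H_{n+k}(x) = − Σ_{i=1}^{min(n,k)} (n choose i)·(k choose i)·i!·H_{n+k−2i}(x). -/
open Polynomial

/-- The coefficient of `H_{n+k-2i}` in the Hermite expansion of `H_n * H_k`. -/
def hermiteLinCoeff (n k i : ℕ) : ℝ :=
  (n.choose i : ℝ) * (k.choose i : ℝ) * (Nat.factorial i : ℝ)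

theorem hermiteLinCoeff_zero_right (n k : ℕ) : hermiteLinCoeff n k 0 = 1 := by
  simp [hermiteLinCoeff]

theorem hermiteLinCoeff_eq_zero {n k i : ℕ} (h : n < i ∨ k < i) : hermiteLinCoeff n k i = 0 := by
  rcases h with h | h <;> simp [hermiteLinCoeff, Nat.choose_eq_zero_of_lt h]

theorem sub_mul_cast_choose (n i : ℕ) :
    ((n : ℝ) - i) * (n.choose i : ℝ) = ((i : ℝ) + 1) * (n.choose (i + 1) : ℝ) := by
  have h : ((n : ℝ) + 1) * (n.choose i : ℝ) = ((n + 1).choose (i + 1) : ℝ) * ((i : ℝ) + 1) := by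
    exact_mod_cast Nat.add_one_mul_choose_eq n i
  rw [Nat.choose_succ_succ'] at h
  push_cast at h
  linarith

theorem add_one_mul_cast_choose (k i : ℕ) :
    ((k : ℝ) + 1) * (k.choose i : ℝ) = ((k : ℝ) + 1 - i) * ((k + 1).choose i : ℝ) := by
  have h : ((k : ℝ) + 1) * (k.choose i : ℝ) = ((k + 1).choose (i + 1) : ℝ) * ((i : ℝ) + 1) := by
    exact_mod_cast Nat.add_one_mul_choose_eq k i
  have h' := sub_mul_cast_choose (k + 1) i
  push_cast at h'
  linarith

theorem hermiteLinCoeff_succ (n k i : ℕ) :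
    hermiteLinCoeff n (k + 2) (i + 1) = hermiteLinCoeff n (k + 1) (i + 1) +
      ((n : ℝ) + k + 1 - 2 * i) * hermiteLinCoeff n (k + 1) i -
      ((k : ℝ) + 1) * hermiteLinCoeff n k i := by
  have h₁ := sub_mul_cast_choose n i
  have h₂ := add_one_mul_cast_choose k i
  simp only [hermiteLinCoeff, Nat.choose_succ_succ' (k + 1) i, Nat.factorial_succ]
  push_cast
  linear_combination (-((k + 1).choose i : ℝ) * (Nat.factorial i : ℝ)) * h₁ +
    ((n.choose i : ℝ) * (Nat.factorial i : ℝ)) * h₂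

theorem mul_eval_hermiteR (x : ℝ) (m : ℕ) :
    x * (hermiteR m).eval x = (hermiteR (m + 1)).eval x + m * (hermiteR (m - 1)).eval x := by
  cases m with
  | zero => simp [hermiteR]
  | succ m => simp [hermiteR]

theorem mul_hermiteLinCoeff_mul_eval (x : ℝ) (n k i : ℕ) :
    x * (hermiteLinCoeff n (k + 1) i * (hermiteR (n + (k + 1) - 2 * i)).eval x) =
      hermiteLinCoeff n (k + 1) i * (hermiteR (n + (k + 2) - 2 * i)).eval x +
      ((n : ℝ) + k + 1 - 2 * i) * hermiteLinCoeff n (k + 1) i *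
        (hermiteR (n + k - 2 * i)).eval x := by
  by_cases h : n < i ∨ k + 1 < i
  · simp [hermiteLinCoeff_eq_zero h]
  · obtain ⟨m, hm⟩ : ∃ m, n + (k + 1) = m + 2 * i := ⟨n + (k + 1) - 2 * i, by omega⟩
    have hm' : (n : ℝ) + (k + 1) = m + 2 * i := by exact_mod_cast hm
    have h₁ : n + (k + 1) - 2 * i = m := by omega
    have h₂ : n + (k + 2) - 2 * i = m + 1 := by omega
    have h₃ : n + k - 2 * i = m - 1 := by omega
    have h₄ : (n : ℝ) + k + 1 - 2 * i = m := by linarith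
    rw [h₁, h₂, h₃, h₄]
    linear_combination hermiteLinCoeff n (k + 1) i * mul_eval_hermiteR x m

/-- Linearization of products of Hermite polynomials; terms with `k < i` vanish, so the range of
summation may be arbitrarily large. -/
theorem eval_hermiteR_mul (x : ℝ) (n k : ℕ) : ∀ N, k ≤ N →
    (hermiteR n).eval x * (hermiteR k).eval x =
      ∑ i ∈ Finset.range (N + 1), hermiteLinCoeff n k i * (hermiteR (n + k - 2 * i)).eval x := by
  induction k using Nat.twoStepInduction with
  | zero =>
    intro N _
    rw [Finset.sum_range_succ', Finset.sum_eq_zero]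
    · simp [hermiteLinCoeff_zero_right, hermiteR]
    · intro i _
      rw [hermiteLinCoeff_eq_zero (Or.inr i.succ_pos), zero_mul]
  | one =>
    intro N hN
    obtain ⟨M, rfl⟩ : ∃ M, N = M + 1 := ⟨N - 1, by omega⟩
    rw [Finset.sum_range_succ', Finset.sum_range_succ', Finset.sum_eq_zero]
    · have h := mul_eval_hermiteR x n
      simp [hermiteLinCoeff, hermiteR]
      linarith
    · intro i _
      rw [hermiteLinCoeff_eq_zero (Or.inr (by omega)), zero_mul]
  | more k ih₀ ih₁ =>
    intro N hN
    obtain ⟨M, rfl⟩ : ∃ M, N = M + 1 := ⟨N - 1, by omega⟩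
    have hrec : (hermiteR n).eval x * (hermiteR (k + 2)).eval x =
        x * ((hermiteR n).eval x * (hermiteR (k + 1)).eval x) -
          ((k : ℝ) + 1) * ((hermiteR n).eval x * (hermiteR k).eval x) := by
      simp only [hermiteR, eval_sub, eval_mul, eval_X, eval_C]
      ring
    have hshift (i : ℕ) : n + (k + 2) - 2 * (i + 1) = n + k - 2 * i := by omega
    rw [hrec, ih₁ (M + 1) (by omega), ih₀ M (by omega), Finset.mul_sum, Finset.mul_sum]
    simp only [mul_hermiteLinCoeff_mul_eval]
    rw [Finset.sum_add_distrib, Finset.sum_range_succ' _ (M + 1),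
      Finset.sum_range_succ (fun i => ((n : ℝ) + k + 1 - 2 * i) * hermiteLinCoeff n (k + 1) i *
        (hermiteR (n + k - 2 * i)).eval x) (M + 1),
      Finset.sum_range_succ' _ (M + 1),
      hermiteLinCoeff_eq_zero (n := n) (k := k + 1) (i := M + 1) (Or.inr (by omega))]
    simp only [hshift, hermiteLinCoeff_succ, hermiteLinCoeff_zero_right, add_mul, sub_mul,
      Finset.sum_add_distrib, Finset.sum_sub_distrib, mul_assoc]
    ring

/-- Aliasing of Hermite polynomials over the zeros of `H_n`: if `H_n(x) = 0`
then `H_{n+k}(x) = − Σ_{i=1}^{min(n,k)} (n choose i)·(k choose i)·i!·H_{n+k−2i}(x)`. -/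
theorem hermite_aliasing (n k : ℕ) (x : ℝ) (hx : (hermiteR n).eval x = 0) :
    (hermiteR (n + k)).eval x =
      - ∑ i ∈ Finset.Icc 1 (min n k),
          (n.choose i : ℝ) * (k.choose i : ℝ) * (Nat.factorial i : ℝ) *
            (hermiteR (n + k - 2 * i)).eval x := by
  have h := eval_hermiteR_mul x n k k le_rfl
  have hsub : Finset.range (min n k + 1) ⊆ Finset.range (k + 1) :=
    Finset.range_subset_range.2 (by omega)
  rw [hx, zero_mul, ← Finset.sum_subset hsub, Finset.sum_range_succ',
    hermiteLinCoeff_zero_right, one_mul, Nat.mul_zero, Nat.sub_zero] at h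
  · have hIcc : Finset.Icc 1 (min n k) = Finset.Ico 1 (min n k + 1) := by
      ext i
      simp
    rw [hIcc, Finset.sum_Ico_eq_sum_range]
    simp only [hermiteLinCoeff] at h
    simp only [Nat.add_sub_cancel, Nat.add_comm 1]
    linarith
  · intro i _ hi
    rw [Finset.mem_range] at hi
    rw [hermiteLinCoeff_eq_zero (by omega), zero_mul]
end

section
/- Let n ≥ 1 and suppose the zero set D of H_n consists of n distinct real numbers. Let p be a real polynomial and write p = q·H_n + r by polynomial division with deg r < n. Then ∫ p dγ = Σ_{z∈D} p(z)·λ_z if and only if ∫ q^{(n)} dγ = 0, where q^{(n)} denotes the n-th derivative of q and λ_z = ∫ l_z dγ. -/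
open MeasureTheory Polynomial ProbabilityTheory

theorem hermiteR_add_two (n : ℕ) :
    hermiteR (n + 2) = X * hermiteR (n + 1) - C ((n : ℝ) + 1) * hermiteR n := rfl

theorem derivative_hermiteR_succ (n : ℕ) :
    derivative (hermiteR (n + 1)) = C ((n : ℝ) + 1) * hermiteR n := by
  induction n using Nat.twoStepInduction with
  | zero => simp [hermiteR]
  | one =>
    simp only [hermiteR, derivative_sub, derivative_mul, derivative_X, derivative_C,
      derivative_one, Nat.cast_one, map_add, map_one]
    ring
  | more n ih₁ ih₂ =>
    rw [hermiteR_add_two (n + 1), derivative_sub, derivative_mul, derivative_C_mul, ih₁, ih₂,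
      hermiteR_add_two n]
    simp only [derivative_X, Nat.cast_add, Nat.cast_one, Nat.cast_ofNat, map_add, map_one,
      map_natCast, map_ofNat]
    ring

theorem hermiteR_succ (n : ℕ) :
    hermiteR (n + 1) = X * hermiteR n - derivative (hermiteR n) := by
  cases n with
  | zero => simp [hermiteR]
  | succ n => rw [hermiteR_add_two, derivative_hermiteR_succ]

theorem integrable_eval_gaussianReal (p : ℝ[X]) (μ : ℝ) (v : NNReal) :
    Integrable (fun x ↦ p.eval x) (gaussianReal μ v) := by
  simp_rw [eval_eq_sum_range]
  refine integrable_finsetSum _ fun i _ ↦ Integrable.const_mul ?_ _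
  refine (integrable_norm_iff (by fun_prop)).mp ?_
  simpa using (memLp_id_gaussianReal (μ := μ) (v := v) i).integrable_norm_pow'

theorem integrable_gaussianPDFReal_mul_eval (p : ℝ[X]) (μ : ℝ) {v : NNReal} (hv : v ≠ 0) :
    Integrable (fun x ↦ gaussianPDFReal μ v x * p.eval x) := by
  have h := integrable_eval_gaussianReal p μ v
  rw [gaussianReal_of_var_ne_zero _ hv, integrable_withDensity_iff_integrable_smul'
    (measurable_gaussianPDF _ _) (ae_of_all _ fun _ ↦ gaussianPDF_lt_top)] at h
  simpa using h

theorem hasDerivAt_gaussianPDFReal_zero_one (x : ℝ) :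
    HasDerivAt (gaussianPDFReal 0 1) (-x * gaussianPDFReal 0 1 x) x := by
  have h : HasDerivAt (fun y : ℝ ↦ -(y - 0) ^ 2 / (2 * ((1 : NNReal) : ℝ))) (-x) x := by
    refine (((hasDerivAt_id x).sub_const 0).pow 2).neg.div_const _ |>.congr_deriv ?_
    simp
    ring
  refine (h.exp.const_mul _).congr_deriv ?_
  rw [gaussianPDFReal]
  ring

/-- Stein's identity for polynomials: integration by parts against the standard Gaussian. -/
theorem integral_eval_X_mul_gaussianReal (p : ℝ[X]) :
    ∫ x, (X * p).eval x ∂(gaussianReal 0 1) =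
      ∫ x, (derivative p).eval x ∂(gaussianReal 0 1) := by
  rw [eq_comm, ← sub_eq_zero, ← integral_sub (integrable_eval_gaussianReal _ _ _)
    (integrable_eval_gaussianReal _ _ _), integral_gaussianReal_eq_integral_smul one_ne_zero]
  simp_rw [← eval_sub, smul_eq_mul]
  refine integral_eq_zero_of_hasDerivAt_of_integrable
    (fun x ↦ ((hasDerivAt_gaussianPDFReal_zero_one x).mul (p.hasDerivAt x)).congr_deriv ?_)
    (integrable_gaussianPDFReal_mul_eval _ _ one_ne_zero)
    (integrable_gaussianPDFReal_mul_eval p _ one_ne_zero)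
  simp only [eval_sub, eval_mul, eval_X]
  ring

theorem integral_eval_mul_hermiteR (n : ℕ) (q : ℝ[X]) :
    ∫ x, (q * hermiteR n).eval x ∂(gaussianReal 0 1) =
      ∫ x, (derivative^[n] q).eval x ∂(gaussianReal 0 1) := by
  induction n generalizing q with
  | zero => simp [hermiteR]
  | succ n ih =>
    have h : q * hermiteR (n + 1) = X * (q * hermiteR n) - q * derivative (hermiteR n) := by
      rw [hermiteR_succ]
      ring
    simp_rw [h, eval_sub]
    rw [integral_sub (integrable_eval_gaussianReal _ _ _) (integrable_eval_gaussianReal _ _ _),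
      integral_eval_X_mul_gaussianReal, ← integral_sub (integrable_eval_gaussianReal _ _ _)
      (integrable_eval_gaussianReal _ _ _), Function.iterate_succ_apply, ← ih]
    simp [derivative_mul]

theorem integral_eval_gaussianReal_eq_sum_lagrange (D : Finset ℝ) {r : ℝ[X]}
    (hr : r.degree < D.card) (μ : ℝ) (v : NNReal) :
    ∫ x, r.eval x ∂(gaussianReal μ v) =
      ∑ z ∈ D, r.eval z * ∫ x, (Lagrange.basis D id z).eval x ∂(gaussianReal μ v) := by
  conv_lhs => rw [Lagrange.eq_interpolate (s := D) (v := id) Function.injective_id.injOn hr,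
    Lagrange.interpolate_apply]
  simp_rw [eval_finsetSum, eval_C_mul]
  rw [integral_finsetSum _ fun i _ ↦ (integrable_eval_gaussianReal _ _ _).const_mul _]
  simp_rw [integral_const_mul, id]

/-- Let `D` be the zero set of `H_n` (with `n` distinct points) and write
`p = q·H_n + r` with `deg r < n`. Then the Gaussian quadrature rule with nodes `D` and
weights `λ_z = ∫ l_z dγ` is exact for `p` if and only if `∫ q⁽ⁿ⁾ dγ = 0`. -/
theorem hermite_quadrature_exact_iff
    (n : ℕ) (hn : 1 ≤ n)
    (D : Finset ℝ) (hcard : D.card = n)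
    (hzero : ∀ x : ℝ, x ∈ D ↔ (hermiteR n).eval x = 0)
    (p q r : Polynomial ℝ)
    (hdiv : p = q * hermiteR n + r) (hr : r.degree < n) :
    (∫ x, p.eval x ∂(gaussianReal 0 1) =
        ∑ z ∈ D, p.eval z * (∫ x, (Lagrange.basis D id z).eval x ∂(gaussianReal 0 1))) ↔
      ∫ x, ((Polynomial.derivative)^[n] q).eval x ∂(gaussianReal 0 1) = 0 := by
  have hpz : ∀ z ∈ D, p.eval z = r.eval z := fun z hz ↦ by
    rw [hdiv, eval_add, eval_mul, (hzero z).mp hz, mul_zero, zero_add]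
  rw [Finset.sum_congr rfl fun z hz ↦ by rw [hpz z hz],
    ← integral_eval_gaussianReal_eq_sum_lagrange D (hcard ▸ hr), hdiv]
  simp_rw [eval_add]
  rw [integral_add (integrable_eval_gaussianReal _ _ _) (integrable_eval_gaussianReal _ _ _),
    integral_eval_mul_hermiteR, add_eq_right]
end

section
/- Let D ⊂ ℝ be a finite set of distinct points and let F be a nonempty subset of D. Let ω_F(x) = Π_{z∈F}(x−z) be the monic polynomial vanishing exactly on F. Then for every z ∈ F, the remainder of the Lagrange basis polynomial l_z^D (with respect to the node set D) under division by ω_F equals the Lagrange basis polynomial l_z^F with respect to the node set F; that is, l_z^D mod ω_F = l_z^F. -/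
open Polynomial

/-- Let `F` be a nonempty subset of a finite set `D ⊂ ℝ` and let
`ω_F = Π_{z∈F}(X − z)`. Then for every `z ∈ F`, the remainder of the Lagrange basis
polynomial `l_z^D` under division by `ω_F` is the Lagrange basis polynomial `l_z^F`. -/
theorem lagrange_remainder_fraction
    (D F : Finset ℝ) (hFD : F ⊆ D) (hFne : F.Nonempty)
    (z : ℝ) (hz : z ∈ F) :
    (Lagrange.basis D id z) %ₘ (∏ w ∈ F, (Polynomial.X - Polynomial.C w)) =
      Lagrange.basis F id z := by
  have hω : (∏ w ∈ F, (X - C w)).Monic := monic_prod_X_sub_C id F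
  have hdegω : (∏ w ∈ F, (X - C w)).degree = (F.card : WithBot ℕ) :=
    Lagrange.degree_nodal (v := id)
  refine eq_of_degrees_lt_of_eval_finset_eq F ?_ ?_ fun w hw => ?_
  · exact hdegω ▸ degree_modByMonic_lt _ hω
  · rw [Lagrange.degree_basis (Set.injOn_id _) hz]
    exact_mod_cast Nat.sub_lt hFne.card_pos one_pos
  · have hroot : (∏ w ∈ F, (X - C w)).eval w = 0 :=
      Lagrange.eval_nodal_at_node (v := id) hw
    rw [modByMonic_eq_sub_mul_div, eval_sub, eval_mul, hroot, zero_mul, sub_zero]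
    rcases eq_or_ne z w with rfl | hzw
    · exact (Lagrange.eval_basis_self (Set.injOn_id _) (hFD hz)).trans
        (Lagrange.eval_basis_self (Set.injOn_id _) hz).symm
    · exact (Lagrange.eval_basis_of_ne (v := id) hzw (hFD hw)).trans
        (Lagrange.eval_basis_of_ne (v := id) hzw hw).symm
end

section
/- Let n, m ≥ 1 and suppose π_n has a zero set D_n of n distinct real numbers and π_m has a zero set D_m of m distinct real numbers. Let f ∈ ℝ[x,y] and suppose f(x,y) = q₁(x,y)·π_n(x) + q₂(x,y)·π_m(y) + Σ_{(a,b)∈D_n×D_m} f(a,b)·l_a^{D_n}(x)·l_b^{D_m}(y), where q₁(x,y) = Σ_j A_j(y)·π_j(x) and q₂(x,y) = Σ_j B_j(x)·π_j(y) for polynomials A_j, B_j (only finitely many nonzero). Then ∫∫ f d(μ⊗μ) = (∫ A_n dμ)·(∫ π_n² dμ) + (∫ B_m dμ)·(∫ π_m² dμ) + Σ_{(a,b)∈D_n×D_m} f(a,b)·λ_a^{(n)}·λ_b^{(m)}, where λ_a^{(n)} = ∫ l_a^{D_n} dμ and λ_b^{(m)} = ∫ l_b^{D_m} dμ. -/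
open MeasureTheory Polynomial

lemma MvPolynomial.eval_aeval_X {σ R : Type*} [CommSemiring R] (v : σ → R) (i : σ)
    (p : Polynomial R) :
    MvPolynomial.eval v (Polynomial.aeval (MvPolynomial.X i) p) = p.eval (v i) := by
  rw [← MvPolynomial.coe_aeval_eq_eval]
  change MvPolynomial.aeval v _ = _
  rw [← Polynomial.aeval_algHom_apply, MvPolynomial.aeval_X, Polynomial.coe_aeval_eq_eval]

/-- By orthogonality, `∑ j, c j * ∫ π_j π_n` reduces to its `n`-th term. -/
lemma sum_mul_integral_mul_of_orthogonal (μ : Measure ℝ) (π : ℕ → Polynomial ℝ)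
    (horth : ∀ j k, j ≠ k → ∫ x, (π j).eval x * (π k).eval x ∂μ = 0)
    {n N : ℕ} (hnN : n < N) (c : ℕ → ℝ) :
    ∑ j ∈ Finset.range N, c j * ∫ x, (π j * π n).eval x ∂μ =
      c n * ∫ x, ((π n).eval x) ^ 2 ∂μ := by
  rw [Finset.sum_eq_single_of_mem n (Finset.mem_range.2 hnN)]
  · simp [pow_two]
  · intro j _ hj
    simp [horth j n hj]

/-- Two-dimensional cubature error formula on a product grid of zeros of
orthogonal polynomials. If `f(x,y) = q₁(x,y)·π_n(x) + q₂(x,y)·π_m(y) + Σ f(a,b) l_a(x) l_b(y)`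
with `q₁(x,y) = Σ_j A_j(y)π_j(x)` and `q₂(x,y) = Σ_j B_j(x)π_j(y)`, then
`∫∫ f d(μ⊗μ) = (∫ A_n dμ)(∫ π_n² dμ) + (∫ B_m dμ)(∫ π_m² dμ) + Σ f(a,b) λ_a λ_b`. -/
theorem cubature_error_formula_two_dim
    (μ : Measure ℝ) [IsProbabilityMeasure μ]
    (hint : ∀ f : Polynomial ℝ, Integrable (fun x => f.eval x) μ)
    (π : ℕ → Polynomial ℝ)
    (hmonic : ∀ k, (π k).Monic)
    (hdeg : ∀ k, (π k).natDegree = k)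
    (horth : ∀ j k, j ≠ k → ∫ x, (π j).eval x * (π k).eval x ∂μ = 0)
    (n m : ℕ) (hn : 1 ≤ n) (hm : 1 ≤ m)
    (Dn Dm : Finset ℝ) (hcardn : Dn.card = n) (hcardm : Dm.card = m)
    (hzn : ∀ x : ℝ, x ∈ Dn ↔ (π n).eval x = 0)
    (hzm : ∀ y : ℝ, y ∈ Dm ↔ (π m).eval y = 0)
    (f q₁ q₂ : MvPolynomial (Fin 2) ℝ)
    (A B : ℕ → Polynomial ℝ) (N : ℕ) (hnN : n < N) (hmN : m < N)
    (hq₁ : q₁ = ∑ j ∈ Finset.range N,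
      Polynomial.aeval (MvPolynomial.X 1) (A j) * Polynomial.aeval (MvPolynomial.X 0) (π j))
    (hq₂ : q₂ = ∑ j ∈ Finset.range N,
      Polynomial.aeval (MvPolynomial.X 0) (B j) * Polynomial.aeval (MvPolynomial.X 1) (π j))
    (hf : f = q₁ * Polynomial.aeval (MvPolynomial.X 0) (π n)
        + q₂ * Polynomial.aeval (MvPolynomial.X 1) (π m)
        + ∑ a ∈ Dn, ∑ b ∈ Dm,
            MvPolynomial.C (MvPolynomial.eval ![a, b] f) *
              Polynomial.aeval (MvPolynomial.X 0) (Lagrange.basis Dn id a) *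
              Polynomial.aeval (MvPolynomial.X 1) (Lagrange.basis Dm id b)) :
    ∫ z : ℝ × ℝ, MvPolynomial.eval ![z.1, z.2] f ∂(μ.prod μ) =
      (∫ y, (A n).eval y ∂μ) * (∫ x, ((π n).eval x) ^ 2 ∂μ)
        + (∫ x, (B m).eval x ∂μ) * (∫ y, ((π m).eval y) ^ 2 ∂μ)
        + ∑ a ∈ Dn, ∑ b ∈ Dm,
            MvPolynomial.eval ![a, b] f *
              (∫ x, (Lagrange.basis Dn id a).eval x ∂μ) *
              (∫ x, (Lagrange.basis Dm id b).eval x ∂μ) := by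
  generalize hc : (fun a b => MvPolynomial.eval ![a, b] f) = c
  have hc' : ∀ a b, MvPolynomial.eval ![a, b] f = c a b := fun a b => by rw [← hc]
  simp only [hc'] at hf ⊢
  have hI : ∀ p q : Polynomial ℝ,
      Integrable (fun z : ℝ × ℝ => p.eval z.1 * q.eval z.2) (μ.prod μ) :=
    fun p q => (hint p).mul_prod (hint q)
  have hprod : ∀ p q : Polynomial ℝ, ∫ z : ℝ × ℝ, p.eval z.1 * q.eval z.2 ∂(μ.prod μ) =
      (∫ x, p.eval x ∂μ) * ∫ y, q.eval y ∂μ :=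
    fun p q => integral_prod_mul (fun x => p.eval x) (fun y => q.eval y)
  have hpt : ∀ z : ℝ × ℝ, c z.1 z.2 =
      ∑ j ∈ Finset.range N, (π j * π n).eval z.1 * (A j).eval z.2
        + ∑ j ∈ Finset.range N, (B j).eval z.1 * (π j * π m).eval z.2
        + ∑ a ∈ Dn, ∑ b ∈ Dm, c a b *
            ((Lagrange.basis Dn id a).eval z.1 * (Lagrange.basis Dm id b).eval z.2) := by
    intro z
    rw [← hc', hf, hq₁, hq₂]
    simp only [map_add, map_mul, map_sum, MvPolynomial.eval_aeval_X, MvPolynomial.eval_C,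
      Matrix.cons_val_zero, Matrix.cons_val_one, Finset.sum_mul, Polynomial.eval_mul]
    congr 1
    · congr 1 <;> exact Finset.sum_congr rfl fun j _ => by ring
    · simp only [mul_assoc]
  have h₁ : Integrable (fun z : ℝ × ℝ =>
      ∑ j ∈ Finset.range N, (π j * π n).eval z.1 * (A j).eval z.2) (μ.prod μ) :=
    integrable_finsetSum _ fun j _ => hI _ _
  have h₂ : Integrable (fun z : ℝ × ℝ =>
      ∑ j ∈ Finset.range N, (B j).eval z.1 * (π j * π m).eval z.2) (μ.prod μ) :=
    integrable_finsetSum _ fun j _ => hI _ _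
  have h₁₂ : Integrable (fun z : ℝ × ℝ =>
      ∑ j ∈ Finset.range N, (π j * π n).eval z.1 * (A j).eval z.2
        + ∑ j ∈ Finset.range N, (B j).eval z.1 * (π j * π m).eval z.2) (μ.prod μ) := h₁.add h₂
  have h₃ : ∀ a b, Integrable (fun z : ℝ × ℝ => c a b *
      ((Lagrange.basis Dn id a).eval z.1 * (Lagrange.basis Dm id b).eval z.2)) (μ.prod μ) :=
    fun a b => (hI _ _).const_mul _
  have h₄ : ∀ a, Integrable (fun z : ℝ × ℝ => ∑ b ∈ Dm, c a b *
      ((Lagrange.basis Dn id a).eval z.1 * (Lagrange.basis Dm id b).eval z.2)) (μ.prod μ) :=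
    fun a => integrable_finsetSum _ fun b _ => h₃ a b
  rw [integral_congr_ae (Filter.Eventually.of_forall hpt),
    integral_add h₁₂ (integrable_finsetSum _ fun a _ => h₄ a), integral_add h₁ h₂,
    integral_finsetSum _ fun j _ => hI _ _, integral_finsetSum _ fun j _ => hI _ _,
    integral_finsetSum _ fun a _ => h₄ a]
  simp_rw [integral_finsetSum _ fun b _ => h₃ _ b, integral_const_mul, hprod]
  rw [← sum_mul_integral_mul_of_orthogonal μ π horth hnN fun j => ∫ y, (A j).eval y ∂μ,
    ← sum_mul_integral_mul_of_orthogonal μ π horth hmN fun j => ∫ x, (B j).eval x ∂μ]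
  simp only [mul_assoc, mul_comm]
end

section
/- Let d ≥ 1 and n_1,…,n_d ≥ 1, and suppose for each i the zero set D_{n_i} of π_{n_i} consists of n_i distinct real numbers. Let D = D_{n_1} × ⋯ × D_{n_d} ⊂ ℝ^d be the product grid. If f ∈ ℝ[x_1,…,x_d] has degree in the variable x_i at most 2n_i − 1 for every i = 1,…,d, then ∫ f dμ^d = Σ_{(z_1,…,z_d)∈D} f(z_1,…,z_d)·λ_{z_1}^{(n_1)}⋯λ_{z_d}^{(n_d)}, where λ_{z_i}^{(n_i)} = ∫ l_{z_i}^{D_{n_i}} dμ. -/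
open MeasureTheory Polynomial

/-- A polynomial orthogonal to every other member of a monic system is orthogonal to all
polynomials of smaller degree. -/
theorem integral_eval_mul_eval_eq_zero_of_degree_lt {μ : Measure ℝ}
    (hint : ∀ f : ℝ[X], Integrable (fun x => f.eval x) μ) {π : ℕ → ℝ[X]}
    (hmonic : ∀ k, (π k).Monic) (hdeg : ∀ k, (π k).natDegree = k)
    (horth : ∀ j k, j ≠ k → ∫ x, (π j).eval x * (π k).eval x ∂μ = 0)
    {n : ℕ} {q : ℝ[X]} (hq : q.degree < n) :
    ∫ x, (π n).eval x * q.eval x ∂μ = 0 := by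
  suffices h : ∀ m ≤ n, ∀ q : ℝ[X], q.degree < m → ∫ x, (π n).eval x * q.eval x ∂μ = 0 from
    h n le_rfl q hq
  intro m
  induction m with
  | zero =>
    intro _ q hq
    have : q = 0 := by
      ext k
      exact (degree_lt_iff_coeff_zero q 0).1 (by exact_mod_cast hq) k (Nat.zero_le k)
    simp [this]
  | succ m ih =>
    intro hm q hq
    have hlow : (q - C (q.coeff m) * π m).degree < m := by
      rw [degree_lt_iff_coeff_zero]
      intro k hk
      rw [coeff_sub, coeff_C_mul]
      rcases hk.eq_or_lt with rfl | hk
      · have : (π m).coeff m = 1 := by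
          have h := (hmonic m).coeff_natDegree
          rwa [hdeg] at h
        simp [this]
      · rw [(degree_lt_iff_coeff_zero q (m + 1)).1 hq k hk,
          coeff_eq_zero_of_natDegree_lt (p := π m) (by rwa [hdeg])]
        simp
    have hsplit : ∀ x, (π n).eval x * q.eval x =
        (π n * (q - C (q.coeff m) * π m)).eval x + (C (q.coeff m) * (π n * π m)).eval x := by
      intro x
      simp only [eval_mul, eval_sub, eval_C]
      ring
    simp_rw [hsplit]
    rw [integral_add (hint _) (hint _)]
    simp_rw [eval_mul, eval_C]
    rw [ih (by omega) _ hlow, integral_const_mul, horth n m (by omega)]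
    simp

/-- Exactness of one-dimensional Gaussian quadrature with `n` nodes in degree less than `2 * n`. -/
theorem integral_eval_eq_sum_lagrange_basis {μ : Measure ℝ}
    (hint : ∀ f : ℝ[X], Integrable (fun x => f.eval x) μ) {π : ℕ → ℝ[X]}
    (hmonic : ∀ k, (π k).Monic) (hdeg : ∀ k, (π k).natDegree = k)
    (horth : ∀ j k, j ≠ k → ∫ x, (π j).eval x * (π k).eval x ∂μ = 0)
    {n : ℕ} {D : Finset ℝ} (hcard : D.card = n) (hzero : ∀ x ∈ D, (π n).eval x = 0)
    {p : ℝ[X]} (hp : p.natDegree < 2 * n) :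
    ∫ x, p.eval x ∂μ =
      ∑ z ∈ D, p.eval z * ∫ x, (Lagrange.basis D id z).eval x ∂μ := by
  have hdegn : (π n).degree = n := by
    rw [degree_eq_natDegree (hmonic n).ne_zero, hdeg]
  have hrem : (p %ₘ π n).degree < D.card := by
    rw [hcard, ← hdegn]
    exact degree_modByMonic_lt p (hmonic n)
  have hquot : (p /ₘ π n).degree < n := by
    refine degree_le_natDegree.trans_lt ?_
    rw [natDegree_divByMonic p (hmonic n), hdeg]
    exact_mod_cast (by omega : p.natDegree - n < n)
  have hmod : p %ₘ π n = ∑ z ∈ D, C (p.eval z) * Lagrange.basis D id z := by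
    rw [Lagrange.eq_interpolate (v := id) (Set.injOn_id _) hrem, Lagrange.interpolate_apply]
    refine Finset.sum_congr rfl fun z hz => ?_
    conv_rhs => rw [← modByMonic_add_div p (π n)]
    simp [hzero z hz]
  calc ∫ x, p.eval x ∂μ
      = ∫ x, (p %ₘ π n).eval x + (π n * (p /ₘ π n)).eval x ∂μ := by
        simp_rw [← eval_add, modByMonic_add_div p (π n)]
    _ = ∫ x, (p %ₘ π n).eval x ∂μ := by
        rw [integral_add (hint _) (hint _)]
        simp_rw [eval_mul]
        rw [integral_eval_mul_eval_eq_zero_of_degree_lt hint hmonic hdeg horth hquot, add_zero]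
    _ = ∑ z ∈ D, p.eval z * ∫ x, (Lagrange.basis D id z).eval x ∂μ := by
        simp_rw [hmod, eval_finsetSum]
        rw [integral_finsetSum _ fun z _ => hint _]
        simp_rw [eval_mul, eval_C, integral_const_mul]

/-- Exactness of the product Gaussian cubature rule in `d` dimensions:
if for each `i` the polynomial `f` has degree at most `2nᵢ − 1` in the variable `xᵢ`, and the
nodes form the product grid of the zeros of the `π_{nᵢ}`, then
`∫ f dμ^d = Σ_{z ∈ D} f(z) · λ_{z_1}⋯λ_{z_d}`. -/
theorem cubature_exactness_product_grid
    (d : ℕ) (hd : 1 ≤ d)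
    (μ : Measure ℝ) [IsProbabilityMeasure μ]
    (hint : ∀ f : Polynomial ℝ, Integrable (fun x => f.eval x) μ)
    (π : ℕ → Polynomial ℝ)
    (hmonic : ∀ k, (π k).Monic)
    (hdeg : ∀ k, (π k).natDegree = k)
    (horth : ∀ j k, j ≠ k → ∫ x, (π j).eval x * (π k).eval x ∂μ = 0)
    (n : Fin d → ℕ) (hn : ∀ i, 1 ≤ n i)
    (D : Fin d → Finset ℝ) (hcard : ∀ i, (D i).card = n i)
    (hzero : ∀ i, ∀ x : ℝ, x ∈ D i ↔ (π (n i)).eval x = 0)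
    (f : MvPolynomial (Fin d) ℝ)
    (hdegf : ∀ i, f.degreeOf i ≤ 2 * n i - 1) :
    ∫ x : Fin d → ℝ, MvPolynomial.eval x f ∂(Measure.pi fun _ => μ) =
      ∑ z ∈ Fintype.piFinset D,
        MvPolynomial.eval z f *
          ∏ i, ∫ x, (Lagrange.basis (D i) id (z i)).eval x ∂μ := by
  have hpow : ∀ (i : Fin d) (k : ℕ), Integrable (fun x : ℝ => x ^ k) μ := fun _ k => by
    simpa using hint (X ^ k)
  simp_rw [MvPolynomial.eval_eq']
  rw [integral_finsetSum _ fun m _ =>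
    (Integrable.fintype_prod (f := fun i (x : ℝ) => x ^ m i) fun i => hpow i (m i)).const_mul _]
  simp_rw [Finset.sum_mul]
  rw [Finset.sum_comm]
  refine Finset.sum_congr rfl fun m hm => ?_
  rw [integral_const_mul, integral_fintype_prod_eq_prod (fun i (x : ℝ) => x ^ m i)]
  simp_rw [mul_assoc, ← Finset.prod_mul_distrib]
  rw [← Finset.mul_sum, ← Finset.prod_univ_sum D
    fun i z => z ^ m i * ∫ x, (Lagrange.basis (D i) id z).eval x ∂μ]
  congr 1
  refine Finset.prod_congr rfl fun i _ => ?_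
  have hmi : (X ^ m i : ℝ[X]).natDegree < 2 * n i := by
    have h := (MvPolynomial.monomial_le_degreeOf i hm).trans (hdegf i)
    have := hn i
    rw [natDegree_X_pow]
    omega
  simpa using integral_eval_eq_sum_lagrange_basis hint hmonic hdeg horth (hcard i)
    (fun x hx => (hzero i x).1 hx) hmi
end
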